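/- arXiv:1306.3905 — 6 statements merged into one kernel-verified Lean document; each statement's English description precedes it below -/
import Mathlib

section
/- (Theorem 1: uniform stability of regularized multi-task kernel regression.) Assume the loss ℓ : Y → Y → ℝ is such that for every y ∈ Y the map a ↦ ℓ(y, a) is convex on Y and C-Lipschitz, i.e., |ℓ(y,a) − ℓ(y,b)| ≤ C‖a − b‖_Y for all a, b ∈ Y. Fix i ∈ {1,…,m}. If f₁ ∈ H is a global minimizer over H of R_reg and f₂ ∈ H is a global minimizer over H of R_reg^{∖i}, then for every x ∈ X and every y ∈ Y, |ℓ(y, ev x f₁) − ℓ(y, ev x f₂)| ≤ C²κ²/(2mλ). In other words, the algorithm is β-uniformly stable with β = C²κ²/(2mλ). -/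
open scoped InnerProductSpace

/-- A strongly convex function grows at least quadratically away from a global minimizer. -/
theorem StrongConvexOn.quadratic_growth_of_forall_le {E : Type*} [NormedAddCommGroup E]
    [NormedSpace ℝ E] {μ : ℝ} {G : E → ℝ} (hG : StrongConvexOn Set.univ μ G) {f : E}
    (hf : ∀ g, G f ≤ G g) (g : E) : G f + μ / 2 * ‖f - g‖ ^ 2 ≤ G g := by
  by_contra! hlt
  set P := μ / 2 * ‖f - g‖ ^ 2 with hP
  have hfg := hf g
  have hPpos : 0 < P := by linarith
  set t := (P - (G g - G f)) / (2 * P) with ht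
  have htP : t * (2 * P) = P - (G g - G f) := by rw [ht]; field_simp
  have ht0 : 0 < t := div_pos (by linarith) (by linarith)
  have ht1 : t ≤ 1 := by rw [ht, div_le_one (by linarith)]; linarith
  have h := hG.2 (Set.mem_univ f) (Set.mem_univ g) (sub_nonneg.2 ht1) ht0.le (by ring)
  have hmin := hf ((1 - t) • f + t • g)
  simp only [smul_eq_mul] at h
  rw [← hP] at h
  have hmul : t * ((1 - t) * P) ≤ t * (G g - G f) := by linarith
  have := le_of_mul_le_mul_left hmul ht0
  linarith

/-- Adding `lam * ‖·‖ ^ 2` to a convex function makes it `2 * lam`-strongly convex. -/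
theorem ConvexOn.strongConvexOn_add_mul_sq_norm {E : Type*} [NormedAddCommGroup E]
    [InnerProductSpace ℝ E] {s : Set E} {F : E → ℝ} (hF : ConvexOn ℝ s F) (lam : ℝ) :
    StrongConvexOn s (2 * lam) fun f => F f + lam * ‖f‖ ^ 2 := by
  rw [strongConvexOn_iff_convex]
  convert hF using 2
  ring

theorem convexOn_empirical_risk {ι X Y H : Type*}
    [NormedAddCommGroup Y] [InnerProductSpace ℝ Y]
    [NormedAddCommGroup H] [InnerProductSpace ℝ H]
    (ev : X → (H →L[ℝ] Y)) (x : ι → X) (y : ι → Y) {ℓ : Y → Y → ℝ}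
    (hconv : ∀ y' : Y, ConvexOn ℝ Set.univ (ℓ y')) (s : Finset ι) {c : ℝ} (hc : 0 ≤ c) :
    ConvexOn ℝ Set.univ fun f => c * ∑ k ∈ s, ℓ (y k) (ev (x k) f) := by
  refine ⟨convex_univ, fun f _ g _ a b ha hb hab => ?_⟩
  simp only [smul_eq_mul]
  calc c * ∑ k ∈ s, ℓ (y k) (ev (x k) (a • f + b • g))
      ≤ c * ∑ k ∈ s, (a * ℓ (y k) (ev (x k) f) + b * ℓ (y k) (ev (x k) g)) := by
        gcongr with k
        simpa using (hconv (y k)).2 (Set.mem_univ (ev (x k) f)) (Set.mem_univ (ev (x k) g))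
          ha hb hab
    _ = _ := by rw [Finset.sum_add_distrib, ← Finset.mul_sum, ← Finset.mul_sum]; ring

/-- Theorem 1: regularized multi-task kernel regression is uniformly stable
with `β = C²κ²/(2mλ)`. -/
theorem stmt3 {X Y H : Type*}
    [NormedAddCommGroup Y] [InnerProductSpace ℝ Y]
    [NormedAddCommGroup H] [InnerProductSpace ℝ H]
    (ev : X → (H →L[ℝ] Y)) (κ : ℝ) (hκ : 0 < κ)
    (hev : ∀ (x : X) (f : H), ‖ev x f‖ ≤ κ * ‖f‖)
    (m : ℕ) (hm : 1 ≤ m) (lam : ℝ) (hlam : 0 < lam)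
    (x : Fin m → X) (y : Fin m → Y)
    (ℓ : Y → Y → ℝ) (C : ℝ)
    (hconv : ∀ y' : Y, ConvexOn ℝ Set.univ (ℓ y'))
    (hlip : ∀ (y' a b : Y), |ℓ y' a - ℓ y' b| ≤ C * ‖a - b‖)
    (i : Fin m) (f₁ f₂ : H)
    (hf₁ : ∀ g : H,
      (1 / (m : ℝ)) * ∑ k, ℓ (y k) (ev (x k) f₁) + lam * ‖f₁‖ ^ 2 ≤
      (1 / (m : ℝ)) * ∑ k, ℓ (y k) (ev (x k) g) + lam * ‖g‖ ^ 2)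
    (hf₂ : ∀ g : H,
      (1 / (m : ℝ)) * ∑ k ∈ Finset.univ.erase i, ℓ (y k) (ev (x k) f₂) + lam * ‖f₂‖ ^ 2 ≤
      (1 / (m : ℝ)) * ∑ k ∈ Finset.univ.erase i, ℓ (y k) (ev (x k) g) + lam * ‖g‖ ^ 2) :
    ∀ (x' : X) (y' : Y),
      |ℓ y' (ev x' f₁) - ℓ y' (ev x' f₂)| ≤ C ^ 2 * κ ^ 2 / (2 * m * lam) := by
  intro x' y'
  have hm0 : (0 : ℝ) < m := by exact_mod_cast hm
  have hc : (0 : ℝ) ≤ 1 / m := by positivity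
  rcases lt_or_ge C 0 with hC | hC
  · have hle := hlip y' (ev x' f₁) (ev x' f₂)
    have := mul_nonpos_of_nonpos_of_nonneg hC.le (norm_nonneg (ev x' f₁ - ev x' f₂))
    exact (hle.trans this).trans (by positivity)
  have hbound (z : X) (w : Y) : |ℓ w (ev z f₁) - ℓ w (ev z f₂)| ≤ C * κ * ‖f₁ - f₂‖ := by
    refine (hlip _ _ _).trans ?_
    rw [← map_sub, mul_assoc]
    exact mul_le_mul_of_nonneg_left (hev _ _) hC
  have h₁ := ((convexOn_empirical_risk ev x y hconv Finset.univ hc).strongConvexOn_add_mul_sq_norm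
    lam).quadratic_growth_of_forall_le hf₁ f₂
  have h₂ := ((convexOn_empirical_risk ev x y hconv (Finset.univ.erase i)
    hc).strongConvexOn_add_mul_sq_norm lam).quadratic_growth_of_forall_le hf₂ f₁
  rw [norm_sub_rev f₂ f₁] at h₂
  simp only [← Finset.add_sum_erase _ _ (Finset.mem_univ i)] at h₁
  have hi := mul_le_mul_of_nonneg_left ((neg_le_abs _).trans (hbound (x i) (y i))) hc
  set d := ‖f₁ - f₂‖
  have hd : 0 ≤ d := norm_nonneg _
  have hsq : 2 * lam * d ^ 2 ≤ 1 / m * (C * κ * d) := by linarith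
  have hdle : d ≤ C * κ / (2 * m * lam) := by
    rcases hd.eq_or_lt with h0 | hpos
    · rw [← h0]; positivity
    · rw [le_div_iff₀ (by positivity)]
      rw [one_div_mul_eq_div, le_div_iff₀ hm0] at hsq
      exact le_of_mul_le_mul_right (by linarith) hpos
  calc _ ≤ C * κ * d := hbound x' y'
    _ ≤ C * κ * (C * κ / (2 * m * lam)) := by gcongr
    _ = _ := by ring
end

section
/- (Theorem 2: generalization bound for a β-stable algorithm.) Let m ≥ 1, β ≥ 0, M > 0 and 0 < δ ≤ 1. Let L_m : (X×Y)^m → (X×Y) → ℝ and L_{m−1} : (X×Y)^{m−1} → (X×Y) → ℝ be jointly measurable maps with 0 ≤ L_m(z)(w) ≤ M and 0 ≤ L_{m−1}(z')(w) ≤ M for all arguments (L_m(z)(w) is the loss on example w of the hypothesis trained on the sample z). Assume removal-based β-uniform stability: for every z ∈ (X×Y)^m, every i ∈ {1,…,m} and every w ∈ X×Y, |L_m(z)(w) − L_{m−1}(z∖i)(w)| ≤ β, where z∖i denotes z with its i-th coordinate removed. Then, with probability at least 1 − δ over z drawn from the product measure P^{⊗m}, ∫_{X×Y} L_m(z)(w)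 dP(w) ≤ (1/m)∑_{k=1}^m L_m(z)(z_k) + 2β + (4mβ + M)·√(ln(1/δ)/(2m)). -/
open MeasureTheory

open ProbabilityTheory in
/-- **Hoeffding's lemma** for a function with oscillation at most `c`. -/
lemma integral_exp_mul_le_of_abs_sub_le {α : Type*} [MeasurableSpace α] (P : Measure α)
    [IsProbabilityMeasure P] {g : α → ℝ} (hg : Measurable g) {c : ℝ}
    (hosc : ∀ x y, |g x - g y| ≤ c) (t : ℝ) :
    ∫ x, Real.exp (t * g x) ∂P ≤ Real.exp (t * ∫ x, g x ∂P + c ^ 2 * t ^ 2 / 8) := by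
  obtain ⟨x₀⟩ : Nonempty α := nonempty_of_isProbabilityMeasure P
  have : Nonempty α := ⟨x₀⟩
  have hbdd : BddBelow (Set.range g) :=
    ⟨g x₀ - c, by rintro _ ⟨x, rfl⟩; linarith [(abs_le.mp (hosc x₀ x)).2]⟩
  have hmem : ∀ x, g x ∈ Set.Icc (⨅ y, g y) ((⨅ y, g y) + c) := fun x ↦ by
    refine ⟨ciInf_le hbdd x, ?_⟩
    have : g x - c ≤ ⨅ y, g y := le_ciInf fun y ↦ by linarith [(abs_le.mp (hosc x y)).2]
    linarith
  have hsub := (hasSubgaussianMGF_of_mem_Icc hg.aemeasurable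
    (Filter.Eventually.of_forall hmem : ∀ᵐ x ∂P, _)).mgf_le t
  have hcoe : (((‖(⨅ y, g y) + c - ⨅ y, g y‖₊ / 2) ^ 2 : NNReal) : ℝ) = c ^ 2 / 4 := by
    simp [div_pow]; norm_num
  rw [hcoe, mgf] at hsub
  have hsplit : ∀ x, Real.exp (t * g x) =
      Real.exp (t * ∫ x, g x ∂P) * Real.exp (t * (g x - ∫ x, g x ∂P)) := fun x ↦ by
    rw [← Real.exp_add]; ring_nf
  simp_rw [hsplit]
  rw [integral_const_mul, Real.exp_add]
  gcongr
  refine hsub.trans_eq ?_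
  ring_nf

/-- The moment generating function bound behind **McDiarmid's inequality**. -/
lemma integral_exp_mul_le_of_bounded_differences {α : Type*} [MeasurableSpace α] (P : Measure α)
    [IsProbabilityMeasure P] {c B : ℝ} (t : ℝ) {n : ℕ} {f : (Fin n → α) → ℝ}
    (hf : Measurable f) (hB : ∀ z, |f z| ≤ B)
    (hdiff : ∀ z i a, |f z - f (Function.update z i a)| ≤ c) :
    ∫ z, Real.exp (t * f z) ∂(Measure.pi fun _ ↦ P) ≤
      Real.exp (t * ∫ z, f z ∂(Measure.pi fun _ ↦ P) + n * (c ^ 2 * t ^ 2 / 8)) := by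
  induction n with
  | zero =>
    have : ∀ z, f z = f default := fun z ↦ congrArg f (Subsingleton.elim _ _)
    simp [this]
  | succ n ih =>
    have hmp := (measurePreserving_piFinSuccAbove (fun _ : Fin (n + 1) ↦ P) 0).symm
    set e := (MeasurableEquiv.piFinSuccAbove (fun _ : Fin (n + 1) ↦ α) 0).symm with he
    have hecons : ∀ p, e p = Fin.cons p.1 p.2 := fun p ↦ by
      simp [he, MeasurableEquiv.piFinSuccAbove_symm_apply, Fin.insertNthEquiv]
    have hfe : Measurable fun p ↦ f (e p) := hf.comp e.measurable
    have hint : Integrable (fun p ↦ f (e p)) (P.prod (Measure.pi fun _ : Fin n ↦ P)) :=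
      Integrable.of_bound hfe.aestronglyMeasurable B (Filter.Eventually.of_forall fun p ↦ hB _)
    have hint_exp : Integrable (fun p ↦ Real.exp (t * f (e p)))
        (P.prod (Measure.pi fun _ : Fin n ↦ P)) :=
      ProbabilityTheory.integrable_exp_mul_of_mem_Icc hfe.aemeasurable
        (Filter.Eventually.of_forall fun p ↦ abs_le.mp (hB (e p)))
    have hsec : ∀ x, Integrable (fun z ↦ f (e (x, z))) (Measure.pi fun _ : Fin n ↦ P) := fun x ↦
      Integrable.of_bound (hfe.comp measurable_prodMk_left).aestronglyMeasurable B
        (Filter.Eventually.of_forall fun p ↦ hB _)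
    set g : α → ℝ := fun x ↦ ∫ z, f (e (x, z)) ∂(Measure.pi fun _ : Fin n ↦ P) with hg
    have hgmeas : Measurable g :=
      (hfe.stronglyMeasurable.integral_prod_right (ν := Measure.pi fun _ : Fin n ↦ P)).measurable
    have hgB : ∀ x, |g x| ≤ B := fun x ↦ by
      simpa using norm_integral_le_of_norm_le_const (μ := Measure.pi fun _ : Fin n ↦ P)
        (f := fun z ↦ f (e (x, z))) (C := B) (Filter.Eventually.of_forall fun z ↦ hB _)
    have hgosc : ∀ x y, |g x - g y| ≤ c := fun x y ↦ by
      simp only [hg]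
      rw [← integral_sub (hsec x) (hsec y)]
      suffices h : ∀ z, ‖f (e (x, z)) - f (e (y, z))‖ ≤ c by
        simpa using norm_integral_le_of_norm_le_const (μ := Measure.pi fun _ : Fin n ↦ P)
          (Filter.Eventually.of_forall h)
      intro z
      have := hdiff (e (x, z)) 0 y
      rw [hecons, Fin.update_cons_zero] at this
      rw [Real.norm_eq_abs, hecons, hecons]
      exact this
    have hinner : ∀ x, ∫ z, Real.exp (t * f (e (x, z))) ∂(Measure.pi fun _ : Fin n ↦ P) ≤
        Real.exp (n * (c ^ 2 * t ^ 2 / 8)) * Real.exp (t * g x) := fun x ↦ by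
      rw [← Real.exp_add, add_comm (_ * _) (t * g x)]
      refine ih (hfe.comp measurable_prodMk_left) (fun z ↦ hB _) fun z i a ↦ ?_
      have := hdiff (e (x, z)) i.succ a
      rw [hecons, ← Fin.cons_update] at this
      rw [hecons, hecons]
      exact this
    have hgint : Integrable (fun x ↦ Real.exp (t * g x)) P :=
      ProbabilityTheory.integrable_exp_mul_of_mem_Icc hgmeas.aemeasurable
        (Filter.Eventually.of_forall fun x ↦ abs_le.mp (hgB x))
    rw [← hmp.integral_comp', ← hmp.integral_comp', integral_prod _ hint_exp, integral_prod _ hint]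
    calc ∫ x, ∫ z, Real.exp (t * f (e (x, z))) ∂(Measure.pi fun _ : Fin n ↦ P) ∂P
        ≤ ∫ x, Real.exp (n * (c ^ 2 * t ^ 2 / 8)) * Real.exp (t * g x) ∂P :=
          integral_mono hint_exp.integral_prod_left (hgint.const_mul _) hinner
      _ = Real.exp (n * (c ^ 2 * t ^ 2 / 8)) * ∫ x, Real.exp (t * g x) ∂P := integral_const_mul _ _
      _ ≤ Real.exp (n * (c ^ 2 * t ^ 2 / 8)) *
          Real.exp (t * ∫ x, g x ∂P + c ^ 2 * t ^ 2 / 8) := by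
          gcongr
          exact integral_exp_mul_le_of_abs_sub_le P hgmeas hgosc t
      _ = _ := by
          rw [← Real.exp_add]
          push_cast
          congr 1
          simp only [hg]
          ring

open ProbabilityTheory in
/-- **McDiarmid's inequality**: a bounded function with differences bounded by `c` is sub-Gaussian
around its mean. -/
lemma hasSubgaussianMGF_of_bounded_differences {α : Type*} [MeasurableSpace α] (P : Measure α)
    [IsProbabilityMeasure P] {c : NNReal} {B : ℝ} {n : ℕ} {f : (Fin n → α) → ℝ}
    (hf : Measurable f) (hB : ∀ z, |f z| ≤ B)
    (hdiff : ∀ z i a, |f z - f (Function.update z i a)| ≤ c) :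
    HasSubgaussianMGF (fun z ↦ f z - ∫ z, f z ∂(Measure.pi fun _ ↦ P)) (n * (c / 2) ^ 2)
      (Measure.pi fun _ ↦ P) := by
  set E := ∫ z, f z ∂(Measure.pi fun _ ↦ P)
  refine ⟨fun t ↦ ?_, fun t ↦ ?_⟩
  · exact integrable_exp_mul_of_mem_Icc (a := -B - E) (b := B - E) (by fun_prop)
      (Filter.Eventually.of_forall fun z ↦
        ⟨by linarith [(abs_le.mp (hB z)).1], by linarith [(abs_le.mp (hB z)).2]⟩)
  · have hsplit : ∀ z, Real.exp (t * (f z - E)) = Real.exp (-(t * E)) * Real.exp (t * f z) :=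
      fun z ↦ by rw [← Real.exp_add]; ring_nf
    simp_rw [mgf, hsplit]
    rw [integral_const_mul]
    refine (mul_le_mul_of_nonneg_left
      (integral_exp_mul_le_of_bounded_differences P t hf hB hdiff) (Real.exp_nonneg _)).trans_eq ?_
    rw [← Real.exp_add]
    congr 1
    push_cast
    ring

/-- Changing one training example changes the loss of a `β`-stable algorithm by at most `2β`. -/
lemma abs_sub_update_le_of_stable {α : Type*} {n : ℕ} {β : ℝ}
    {L : (Fin (n + 1) → α) → α → ℝ} {L' : (Fin n → α) → α → ℝ}
    (hstab : ∀ z (i : Fin (n + 1)) w, |L z w - L' (i.removeNth z) w| ≤ β)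
    (z : Fin (n + 1) → α) (i : Fin (n + 1)) (a w : α) :
    |L z w - L (Function.update z i a) w| ≤ 2 * β := by
  have h₁ := abs_le.mp (hstab z i w)
  have h₂ := abs_le.mp (hstab (Function.update z i a) i w)
  rw [Fin.removeNth_update] at h₂
  exact abs_le.mpr ⟨by linarith, by linarith⟩

/-- The expected loss on a fresh example exceeds the expected loss on the `k`-th training example
by at most `2β`. -/
lemma integral_risk_sub_loss_le_of_stable {α : Type*} [MeasurableSpace α] (P : Measure α)
    [IsProbabilityMeasure P] {n : ℕ} {β M : ℝ}
    {L : (Fin (n + 1) → α) → α → ℝ} {L' : (Fin n → α) → α → ℝ}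
    (hL : Measurable (Function.uncurry L)) (hL' : Measurable (Function.uncurry L'))
    (hLbound : ∀ z w, |L z w| ≤ M) (hL'bound : ∀ z w, |L' z w| ≤ M)
    (hstab : ∀ z (i : Fin (n + 1)) w, |L z w - L' (i.removeNth z) w| ≤ β) (k : Fin (n + 1)) :
    ∫ z, (∫ w, L z w ∂P) - L z (z k) ∂(Measure.pi fun _ ↦ P) ≤ 2 * β := by
  have hmp := measurePreserving_piFinSuccAbove (fun _ : Fin (n + 1) ↦ P) k
  set e := MeasurableEquiv.piFinSuccAbove (fun _ : Fin (n + 1) ↦ α) k with he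
  have hR' : Measurable fun z ↦ ∫ w, L' z w ∂P :=
    (hL'.stronglyMeasurable.integral_prod_right (ν := P)).measurable
  have hR : Measurable fun z ↦ ∫ w, L z w ∂P :=
    (hL.stronglyMeasurable.integral_prod_right (ν := P)).measurable
  have hR'M : ∀ z, |∫ w, L' z w ∂P| ≤ M := fun z ↦ by
    simpa using norm_integral_le_of_norm_le_const (μ := P) (f := L' z) (C := M)
      (Filter.Eventually.of_forall fun w ↦ hL'bound z w)
  have hRM : ∀ z, |∫ w, L z w ∂P| ≤ M := fun z ↦ by
    simpa using norm_integral_le_of_norm_le_const (μ := P) (f := L z) (C := M)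
      (Filter.Eventually.of_forall fun w ↦ hLbound z w)
  have hLk : Measurable fun z : Fin (n + 1) → α ↦ L z (z k) :=
    hL.comp (measurable_id.prodMk (measurable_pi_apply k))
  have hL's : Measurable fun p : α × (Fin n → α) ↦ L' p.2 p.1 := hL'.comp measurable_swap
  have hi₁ : Integrable (fun p : α × (Fin n → α) ↦ ∫ w, L' p.2 w ∂P)
      (P.prod (Measure.pi fun _ ↦ P)) :=
    Integrable.of_bound (hR'.comp measurable_snd).aestronglyMeasurable M
      (Filter.Eventually.of_forall fun p ↦ hR'M _)
  have hi₂ : Integrable (fun p : α × (Fin n → α) ↦ L' p.2 p.1)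
      (P.prod (Measure.pi fun _ ↦ P)) :=
    Integrable.of_bound hL's.aestronglyMeasurable M
      (Filter.Eventually.of_forall fun p ↦ hL'bound _ _)
  set G : α × (Fin n → α) → ℝ := fun p ↦ (∫ w, L' p.2 w ∂P) - L' p.2 p.1 with hG
  have hGint : Integrable G (P.prod (Measure.pi fun _ ↦ P)) := hi₁.sub hi₂
  have hGzero : ∫ p, G p ∂(P.prod (Measure.pi fun _ ↦ P)) = 0 := by
    rw [hG, integral_sub hi₁ hi₂, integral_prod_symm _ hi₁, integral_prod_symm _ hi₂]
    simp
  have hpt : ∀ z : Fin (n + 1) → α, (∫ w, L z w ∂P) - L z (z k) ≤ G (e z) + 2 * β := fun z ↦ by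
    have hez : e z = (z k, k.removeNth z) := rfl
    have hL'i : Integrable (L' (k.removeNth z)) P :=
      Integrable.of_bound (hL'.comp measurable_prodMk_left).aestronglyMeasurable M
        (Filter.Eventually.of_forall fun w ↦ hL'bound _ w)
    have h₁ : ∫ w, L z w ∂P ≤ ∫ w, (L' (k.removeNth z) w + β) ∂P := by
      refine integral_mono ?_ (hL'i.add (integrable_const _)) fun w ↦ ?_
      · exact Integrable.of_bound (hL.comp measurable_prodMk_left).aestronglyMeasurable M
          (Filter.Eventually.of_forall fun w ↦ hLbound z w)
      · have := (abs_le.mp (hstab z k w)).2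
        dsimp only
        linarith
    rw [integral_add hL'i (integrable_const _)] at h₁
    have h₂ := (abs_le.mp (hstab z k (z k))).1
    simp only [integral_const, probReal_univ, one_smul] at h₁
    rw [hez, hG]
    dsimp only
    linarith
  have hGe : Integrable (fun z ↦ G (e z)) (Measure.pi fun _ : Fin (n + 1) ↦ P) :=
    (hmp.integrable_comp_emb e.measurableEmbedding).mpr hGint
  have hΦ : Integrable (fun z ↦ (∫ w, L z w ∂P) - L z (z k))
      (Measure.pi fun _ : Fin (n + 1) ↦ P) :=
    (Integrable.of_bound hR.aestronglyMeasurable M (Filter.Eventually.of_forall hRM)).sub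
      (Integrable.of_bound hLk.aestronglyMeasurable M
        (Filter.Eventually.of_forall fun z ↦ hLbound _ _))
  refine (integral_mono hΦ (hGe.add (integrable_const _)) hpt).trans_eq ?_
  rw [integral_add' hGe (integrable_const _), hmp.integral_comp', hGzero]
  simp

/-- Theorem 2 (Bousquet–Elisseeff): generalization bound for a removal-based
`β`-uniformly stable algorithm with loss bounded by `M`. Here `m = n + 1 ≥ 1`. -/
theorem stmt4 {X Y : Type*} [MeasurableSpace X] [MeasurableSpace Y]
    (P : Measure (X × Y)) [IsProbabilityMeasure P]
    (n : ℕ) (β M δ : ℝ) (hβ : 0 ≤ β) (hM : 0 < M) (hδ0 : 0 < δ) (hδ1 : δ ≤ 1)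
    (L : (Fin (n + 1) → X × Y) → (X × Y) → ℝ)
    (L' : (Fin n → X × Y) → (X × Y) → ℝ)
    (hLmeas : Measurable (Function.uncurry L))
    (hL'meas : Measurable (Function.uncurry L'))
    (hLbound : ∀ z w, 0 ≤ L z w ∧ L z w ≤ M)
    (hL'bound : ∀ z' w, 0 ≤ L' z' w ∧ L' z' w ≤ M)
    (hstab : ∀ (z : Fin (n + 1) → X × Y) (i : Fin (n + 1)) (w : X × Y),
      |L z w - L' (i.removeNth z) w| ≤ β) :
    ENNReal.ofReal (1 - δ) ≤
      (Measure.pi fun _ : Fin (n + 1) => P)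
        {z | ∫ w, L z w ∂P ≤
          (1 / ((n : ℝ) + 1)) * ∑ k, L z (z k) + 2 * β +
          (4 * ((n : ℝ) + 1) * β + M) * Real.sqrt (Real.log (1 / δ) / (2 * ((n : ℝ) + 1)))} := by
  have habs : ∀ z w, |L z w| ≤ M := fun z w ↦
    abs_le.mpr ⟨by linarith [(hLbound z w).1], (hLbound z w).2⟩
  have habs' : ∀ z w, |L' z w| ≤ M := fun z w ↦
    abs_le.mpr ⟨by linarith [(hL'bound z w).1], (hL'bound z w).2⟩
  have hm : (0 : ℝ) < (n : ℝ) + 1 := by positivity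
  set μ := Measure.pi fun _ : Fin (n + 1) ↦ P
  set Φ : (Fin (n + 1) → X × Y) → ℝ :=
    fun z ↦ (1 / ((n : ℝ) + 1)) * ∑ k, ((∫ w, L z w ∂P) - L z (z k)) with hΦ
  have hΦeq : ∀ z, Φ z = (∫ w, L z w ∂P) - (1 / ((n : ℝ) + 1)) * ∑ k, L z (z k) := fun z ↦ by
    simp only [hΦ, Finset.sum_sub_distrib, Finset.sum_const, Finset.card_univ, Fintype.card_fin,
      nsmul_eq_mul]
    push_cast
    field_simp
  have hR : Measurable fun z ↦ ∫ w, L z w ∂P :=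
    (hLmeas.stronglyMeasurable.integral_prod_right (ν := P)).measurable
  have hRM : ∀ z, |∫ w, L z w ∂P| ≤ M := fun z ↦ by
    simpa using norm_integral_le_of_norm_le_const (μ := P) (f := L z) (C := M)
      (Filter.Eventually.of_forall fun w ↦ habs z w)
  have hLint : ∀ z, Integrable (L z) P := fun z ↦
    Integrable.of_bound (hLmeas.comp measurable_prodMk_left).aestronglyMeasurable M
      (Filter.Eventually.of_forall fun w ↦ habs z w)
  have hLk : ∀ k, Measurable fun z : Fin (n + 1) → X × Y ↦ L z (z k) := fun k ↦
    hLmeas.comp (measurable_id.prodMk (measurable_pi_apply k))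
  have hterm : ∀ k, Measurable fun z : Fin (n + 1) → X × Y ↦ (∫ w, L z w ∂P) - L z (z k) :=
    fun k ↦ hR.sub (hLk k)
  have htermB : ∀ k z, |(∫ w, L z w ∂P) - L z (z k)| ≤ 2 * M := fun k z ↦
    (abs_sub _ _).trans (by linarith [hRM z, habs z (z k)])
  have hΦmeas : Measurable Φ := (Finset.measurable_sum _ fun k _ ↦ hterm k).const_mul _
  have havg : ∀ (u : Fin (n + 1) → ℝ) (b : ℝ), ∑ k, |u k| ≤ ((n : ℝ) + 1) * b →
      |(1 / ((n : ℝ) + 1)) * ∑ k, u k| ≤ b := fun u b hu ↦ by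
    rw [abs_mul, abs_of_pos (by positivity : (0 : ℝ) < 1 / ((n : ℝ) + 1)), one_div,
      inv_mul_le_iff₀ hm]
    exact (Finset.abs_sum_le_sum_abs _ _).trans hu
  have hΦB : ∀ z, |Φ z| ≤ 2 * M := fun z ↦ havg _ _ <| by
    refine (Finset.sum_le_sum fun k _ ↦ htermB k z).trans_eq ?_
    simp
  have hΦmean : ∫ z, Φ z ∂μ ≤ 2 * β := by
    have hint : ∀ k ∈ Finset.univ, Integrable (fun z ↦ (∫ w, L z w ∂P) - L z (z k)) μ := fun k _ ↦
      Integrable.of_bound (hterm k).aestronglyMeasurable (2 * M)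
        (Filter.Eventually.of_forall fun z ↦ htermB k z)
    rw [hΦ, integral_const_mul, integral_finsetSum _ hint, one_div, inv_mul_le_iff₀ hm]
    refine (Finset.sum_le_sum fun k _ ↦
      integral_risk_sub_loss_le_of_stable P hLmeas hL'meas habs habs' hstab k).trans_eq ?_
    simp
  have hΦdiff : ∀ z i a, |Φ z - Φ (Function.update z i a)| ≤ 4 * β + M / ((n : ℝ) + 1) := by
    intro z i a
    have hrisk : |(∫ w, L z w ∂P) - ∫ w, L (Function.update z i a) w ∂P| ≤ 2 * β := by
      rw [← integral_sub (hLint _) (hLint _)]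
      simpa using norm_integral_le_of_norm_le_const (μ := P)
        (f := fun w ↦ L z w - L (Function.update z i a) w) (C := 2 * β)
        (Filter.Eventually.of_forall fun w ↦ abs_sub_update_le_of_stable hstab z i a w)
    have hemp : |(1 / ((n : ℝ) + 1)) *
        ∑ k, (L z (z k) - L (Function.update z i a) (Function.update z i a k))| ≤
          2 * β + M / ((n : ℝ) + 1) := by
      refine havg _ _ ?_
      have hk : ∀ k, |L z (z k) - L (Function.update z i a) (Function.update z i a k)| ≤
          2 * β + if k = i then M else 0 := fun k ↦ by
        split_ifs with h
        · have h₁ := hLbound z (z k)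
          have h₂ := hLbound (Function.update z i a) (Function.update z i a k)
          exact abs_le.mpr ⟨by linarith, by linarith⟩
        · rw [Function.update_of_ne h, add_zero]
          exact abs_sub_update_le_of_stable hstab z i a (z k)
      refine (Finset.sum_le_sum fun k _ ↦ hk k).trans_eq ?_
      simp only [Finset.sum_add_distrib, Finset.sum_const, Finset.card_univ, Fintype.card_fin,
        nsmul_eq_mul, Finset.sum_ite_eq', Finset.mem_univ, if_true]
      push_cast
      field_simp
    rw [Finset.sum_sub_distrib, mul_sub] at hemp
    rw [hΦeq, hΦeq]
    rw [abs_le] at hrisk hemp ⊢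
    constructor <;> linarith [hrisk.1, hrisk.2, hemp.1, hemp.2]
  set c : NNReal := ⟨4 * β + M / ((n : ℝ) + 1), by positivity⟩
  have hcval : (c : ℝ) = 4 * β + M / ((n : ℝ) + 1) := rfl
  have hcm : ((n : ℝ) + 1) * c = 4 * ((n : ℝ) + 1) * β + M := by
    rw [hcval]
    field_simp
  have hcpos : (0 : ℝ) < c := by
    rw [hcval]
    positivity
  have hlog : 0 ≤ Real.log (1 / δ) := Real.log_nonneg ((one_le_div hδ0).mpr hδ1)
  set s := Real.sqrt (Real.log (1 / δ) / (2 * ((n : ℝ) + 1))) with hs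
  have hs2 : s ^ 2 = Real.log (1 / δ) / (2 * ((n : ℝ) + 1)) := Real.sq_sqrt (by positivity)
  have htail := (hasSubgaussianMGF_of_bounded_differences P (c := c) hΦmeas hΦB hΦdiff).measure_ge_le
    (ε := (4 * ((n : ℝ) + 1) * β + M) * s) (by positivity)
  have hexp : Real.exp (-((4 * ((n : ℝ) + 1) * β + M) * s) ^ 2 /
      (2 * (((n + 1 : ℕ) * (c / 2) ^ 2 : NNReal) : ℝ))) = δ := by
    rw [← hcm, mul_pow, hs2]
    have : -((((n : ℝ) + 1) * c) ^ 2 * (Real.log (1 / δ) / (2 * ((n : ℝ) + 1)))) /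
        (2 * (((n + 1 : ℕ) * (c / 2) ^ 2 : NNReal) : ℝ)) = Real.log δ := by
      rw [one_div, Real.log_inv]
      push_cast
      field_simp
    rw [this, Real.exp_log hδ0]
  rw [hexp] at htail
  set S := {z | ∫ w, L z w ∂P ≤ (1 / ((n : ℝ) + 1)) * ∑ k, L z (z k) + 2 * β +
    (4 * ((n : ℝ) + 1) * β + M) * s} with hS
  have hSmeas : MeasurableSet S :=
    measurableSet_le hR
      ((((Finset.measurable_sum _ fun k _ ↦ hLk k).const_mul _).add_const _).add_const _)
  have hcompl : μ.real Sᶜ ≤ δ := by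
    refine (measureReal_mono fun z hz ↦ ?_).trans htail
    simp only [hS, Set.mem_compl_iff, Set.mem_ofPred_eq, not_le] at hz
    have := hΦeq z
    simp only [Set.mem_ofPred_eq]
    linarith
  rw [probReal_compl_eq_one_sub hSmeas] at hcompl
  exact ENNReal.ofReal_le_of_le_toReal (by rw [← measureReal_def]; linarith)
end

section
/- (Lemma 2: Lipschitz-type bound for the square loss at regularized minimizers.) Suppose ‖y_k‖_Y ≤ C_y for all k = 1,…,m. Fix i ∈ {1,…,m}, let f_Z ∈ H be a global minimizer over H of f ↦ (1/m)∑_{k=1}^m ‖y_k − ev x_k f‖_Y² + λ‖f‖_H², and let f_{Z∖i} ∈ H be a global minimizer over H of f ↦ (1/m)∑_{k≠i} ‖y_k − ev x_k f‖_Y² + λ‖f‖_H². Then for every x ∈ X and every y ∈ Y with ‖y‖_Y ≤ C_y, | ‖y − ev x f_Z‖_Y² − ‖y − ev x f_{Z∖i}‖_Y² | ≤ 2 C_y (1 + κ/√λ) · ‖ev x f_Z − ev x f_{Z∖i}‖_Y. -/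
open scoped InnerProductSpace

/-- The squared distances of two points to a common centre differ by at most `2 * B` times the
distance of the points, when both lie within distance `B` of the centre. -/
theorem abs_norm_sub_sq_sub_norm_sub_sq_le {E : Type*} [SeminormedAddCommGroup E] {a u v : E}
    {B : ℝ} (hu : ‖a - u‖ ≤ B) (hv : ‖a - v‖ ≤ B) :
    |‖a - u‖ ^ 2 - ‖a - v‖ ^ 2| ≤ 2 * B * ‖u - v‖ := by
  have hdiff : |‖a - u‖ - ‖a - v‖| ≤ ‖u - v‖ := by
    simpa [norm_sub_rev v u] using abs_norm_sub_norm_le (a - u) (a - v)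
  rw [sq_sub_sq, abs_mul, abs_of_nonneg (by positivity)]
  exact mul_le_mul (by linarith) hdiff (abs_nonneg _) (by linarith [norm_nonneg (a - u)])

/-- A function whose regularized square risk does not exceed that of `0` has norm at most
`C / √lam`, where `C` bounds the outputs. -/
theorem norm_le_div_sqrt_of_regularized_risk_le {ι Y H : Type*} [Fintype ι]
    [SeminormedAddCommGroup Y] [NormedSpace ℝ Y] [SeminormedAddCommGroup H] [NormedSpace ℝ H]
    (L : ι → (H →L[ℝ] Y)) (y : ι → Y) (s : Finset ι) {C lam : ℝ} (hC : 0 ≤ C) (hlam : 0 < lam)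
    (hy : ∀ k, ‖y k‖ ≤ C) (f : H)
    (hf : (1 / (Fintype.card ι : ℝ)) * ∑ k ∈ s, ‖y k - L k f‖ ^ 2 + lam * ‖f‖ ^ 2 ≤
      (1 / (Fintype.card ι : ℝ)) * ∑ k ∈ s, ‖y k - L k 0‖ ^ 2 + lam * ‖(0 : H)‖ ^ 2) :
    ‖f‖ ≤ C / √lam := by
  have hsum : ∑ k ∈ s, ‖y k - L k 0‖ ^ 2 ≤ (Fintype.card ι : ℝ) * C ^ 2 :=
    calc ∑ k ∈ s, ‖y k - L k 0‖ ^ 2 ≤ ∑ k, ‖y k - L k 0‖ ^ 2 :=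
          Finset.sum_le_univ_sum_of_nonneg fun _ ↦ by positivity
      _ ≤ ∑ _k : ι, C ^ 2 := Finset.sum_le_sum fun k _ ↦ by
          simpa using pow_le_pow_left₀ (norm_nonneg _) (hy k) 2
      _ = (Fintype.card ι : ℝ) * C ^ 2 := by simp
  have hmean : (1 / (Fintype.card ι : ℝ)) * ∑ k ∈ s, ‖y k - L k 0‖ ^ 2 ≤ C ^ 2 := by
    rw [one_div]
    exact inv_mul_le_of_le_mul₀ (by positivity) (by positivity) hsum
  have hrisk : 0 ≤ (1 / (Fintype.card ι : ℝ)) * ∑ k ∈ s, ‖y k - L k f‖ ^ 2 := by positivity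
  have hsq : lam * ‖f‖ ^ 2 ≤ C ^ 2 := by
    rw [norm_zero] at hf
    linarith
  rw [le_div_iff₀ (Real.sqrt_pos.2 hlam)]
  refine (le_abs_self _).trans (abs_le_of_sq_le_sq ?_ hC)
  rwa [mul_pow, Real.sq_sqrt hlam.le, mul_comm]

/-- Lemma 2: Lipschitz-type bound for the square loss at the regularized minimizers
of the full and leave-one-out regularized least squares risks. -/
theorem stmt7 {X Y H : Type*}
    [NormedAddCommGroup Y] [InnerProductSpace ℝ Y]
    [NormedAddCommGroup H] [InnerProductSpace ℝ H]
    (ev : X → (H →L[ℝ] Y)) (κ : ℝ) (hκ : 0 < κ)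
    (hev : ∀ (x : X) (f : H), ‖ev x f‖ ≤ κ * ‖f‖)
    (m : ℕ) (hm : 1 ≤ m) (lam : ℝ) (hlam : 0 < lam) (Cy : ℝ) (hCy : 0 < Cy)
    (x : Fin m → X) (y : Fin m → Y)
    (hy : ∀ k, ‖y k‖ ≤ Cy)
    (i : Fin m) (fZ fZi : H)
    (hfZ : ∀ g : H,
      (1 / (m : ℝ)) * ∑ k, ‖y k - ev (x k) fZ‖ ^ 2 + lam * ‖fZ‖ ^ 2 ≤
      (1 / (m : ℝ)) * ∑ k, ‖y k - ev (x k) g‖ ^ 2 + lam * ‖g‖ ^ 2)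
    (hfZi : ∀ g : H,
      (1 / (m : ℝ)) * ∑ k ∈ Finset.univ.erase i, ‖y k - ev (x k) fZi‖ ^ 2 + lam * ‖fZi‖ ^ 2 ≤
      (1 / (m : ℝ)) * ∑ k ∈ Finset.univ.erase i, ‖y k - ev (x k) g‖ ^ 2 + lam * ‖g‖ ^ 2) :
    ∀ (x' : X) (y' : Y), ‖y'‖ ≤ Cy →
      |‖y' - ev x' fZ‖ ^ 2 - ‖y' - ev x' fZi‖ ^ 2| ≤
        2 * Cy * (1 + κ / Real.sqrt lam) * ‖ev x' fZ - ev x' fZi‖ := by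
  intro x' y' hy'
  have hdist : ∀ f : H, ‖f‖ ≤ Cy / √lam → ‖y' - ev x' f‖ ≤ Cy * (1 + κ / √lam) := fun f hf ↦
    calc ‖y' - ev x' f‖ ≤ ‖y'‖ + ‖ev x' f‖ := norm_sub_le _ _
      _ ≤ Cy + κ * (Cy / √lam) :=
          add_le_add hy' ((hev x' f).trans (mul_le_mul_of_nonneg_left hf hκ.le))
      _ = Cy * (1 + κ / √lam) := by ring
  have hZ := hdist fZ <| norm_le_div_sqrt_of_regularized_risk_le (fun k ↦ ev (x k)) y
    Finset.univ hCy.le hlam hy fZ (by simpa only [Fintype.card_fin] using hfZ 0)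
  have hZi := hdist fZi <| norm_le_div_sqrt_of_regularized_risk_le (fun k ↦ ev (x k)) y
    (Finset.univ.erase i) hCy.le hlam hy fZi (by simpa only [Fintype.card_fin] using hfZi 0)
  simpa only [mul_assoc] using abs_norm_sub_sq_sub_norm_sub_sq_le hZ hZi
end

section
/- (Uniform stability of functional-response ridge regression.) Suppose ‖y_k‖_Y ≤ C_y for all k = 1,…,m. Fix i ∈ {1,…,m}, let f_Z ∈ H be a global minimizer over H of f ↦ (1/m)∑_{k=1}^m ‖y_k − ev x_k f‖_Y² + λ‖f‖_H², and let f_{Z∖i} ∈ H be a global minimizer over H of f ↦ (1/m)∑_{k≠i} ‖y_k − ev x_k f‖_Y² + λ‖f‖_H². Then for every x ∈ X and every y ∈ Y with ‖y‖_Y ≤ C_y, | ‖y − ev x f_Z‖_Y² − ‖y − ev x f_{Z∖i}‖_Y² | ≤ 2 C_y² κ² (1 + κ/√λ)² / (mλ); i.e., the ridge regression algorithm is β-uniformly stable with β = 2 C_y² κ² (1 + κ/√λ)² / (mλ). -/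
open scoped InnerProductSpace

section RidgeRegression

variable {ι Y H : Type*} [NormedAddCommGroup Y] [InnerProductSpace ℝ Y]
  [NormedAddCommGroup H] [InnerProductSpace ℝ H]

/-- First-order optimality condition for a minimizer of a ridge regression functional. -/
theorem ridge_normal_equation (s : Finset ι) (T : ι → H →L[ℝ] Y) (y : ι → Y) (c lam : ℝ) (f : H)
    (hf : ∀ g : H, c * ∑ k ∈ s, ‖y k - T k f‖ ^ 2 + lam * ‖f‖ ^ 2 ≤
      c * ∑ k ∈ s, ‖y k - T k g‖ ^ 2 + lam * ‖g‖ ^ 2) (g : H) :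
    c * ∑ k ∈ s, ⟪y k - T k f, T k g⟫_ℝ = lam * ⟪f, g⟫_ℝ := by
  have expand (t : ℝ) : c * ∑ k ∈ s, ‖y k - T k (f + t • g)‖ ^ 2 + lam * ‖f + t • g‖ ^ 2 =
      c * ∑ k ∈ s, ‖y k - T k f‖ ^ 2 + lam * ‖f‖ ^ 2 +
      ((c * ∑ k ∈ s, ‖T k g‖ ^ 2 + lam * ‖g‖ ^ 2) * (t * t) +
        2 * (lam * ⟪f, g⟫_ℝ - c * ∑ k ∈ s, ⟪y k - T k f, T k g⟫_ℝ) * t) := by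
    have hk (k : ι) : ‖y k - T k (f + t • g)‖ ^ 2 =
        ‖y k - T k f‖ ^ 2 + (t * t) * ‖T k g‖ ^ 2 - 2 * t * ⟪y k - T k f, T k g⟫_ℝ := by
      rw [map_add, map_smul, ← sub_sub, norm_sub_sq_real, inner_smul_right, norm_smul, mul_pow,
        Real.norm_eq_abs, sq_abs]
      ring
    simp only [hk, Finset.sum_sub_distrib, Finset.sum_add_distrib, ← Finset.mul_sum]
    rw [norm_add_sq_real, inner_smul_right, norm_smul, mul_pow, Real.norm_eq_abs, sq_abs]
    ring
  have hdisc := discrim_le_zero (a := c * ∑ k ∈ s, ‖T k g‖ ^ 2 + lam * ‖g‖ ^ 2)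
    (b := 2 * (lam * ⟪f, g⟫_ℝ - c * ∑ k ∈ s, ⟪y k - T k f, T k g⟫_ℝ)) (c := 0)
    fun t ↦ by linarith [hf (f + t • g), expand t]
  rw [discrim, mul_zero, sub_zero] at hdisc
  linarith [pow_eq_zero_iff two_ne_zero |>.mp (le_antisymm hdisc (sq_nonneg _))]

/-- A priori bound on a minimizer of a ridge regression functional with bounded responses. -/
theorem ridge_norm_le (s : Finset ι) (T : ι → H →L[ℝ] Y) (y : ι → Y) {c lam C : ℝ} (f : H)
    (hc : 0 ≤ c) (hcs : c * s.card ≤ 1) (hlam : 0 < lam) (hC : 0 ≤ C) (hy : ∀ k ∈ s, ‖y k‖ ≤ C)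
    (hf : ∀ g : H, c * ∑ k ∈ s, ‖y k - T k f‖ ^ 2 + lam * ‖f‖ ^ 2 ≤
      c * ∑ k ∈ s, ‖y k - T k g‖ ^ 2 + lam * ‖g‖ ^ 2) :
    ‖f‖ ≤ C / √lam := by
  have hsum : ∑ k ∈ s, ‖y k‖ ^ 2 ≤ s.card * C ^ 2 := by
    simpa using Finset.sum_le_card_nsmul s (fun k ↦ ‖y k‖ ^ 2) (C ^ 2)
      fun k hk ↦ pow_le_pow_left₀ (norm_nonneg _) (hy k hk) 2
  have h0 := hf 0
  simp only [map_zero, sub_zero, norm_zero] at h0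
  have hres : 0 ≤ c * ∑ k ∈ s, ‖y k - T k f‖ ^ 2 := by positivity
  have hsq : lam * ‖f‖ ^ 2 ≤ C ^ 2 := by
    nlinarith [mul_le_mul_of_nonneg_left hsum hc, mul_le_mul_of_nonneg_right hcs (sq_nonneg C)]
  rw [le_div_iff₀ (Real.sqrt_pos.mpr hlam)]
  refine abs_le_of_sq_le_sq' ?_ hC |>.2
  rw [mul_pow, Real.sq_sqrt hlam.le]
  linarith

theorem norm_sub_apply_le {T : H →L[ℝ] Y} {y : Y} {f : H} {κ C r : ℝ} (hκ : 0 ≤ κ)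
    (hT : ‖T f‖ ≤ κ * ‖f‖) (hy : ‖y‖ ≤ C) (hf : ‖f‖ ≤ C / r) :
    ‖y - T f‖ ≤ C * (1 + κ / r) :=
  calc ‖y - T f‖ ≤ ‖y‖ + ‖T f‖ := norm_sub_le _ _
    _ ≤ C + κ * (C / r) := add_le_add hy (hT.trans (mul_le_mul_of_nonneg_left hf hκ))
    _ = C * (1 + κ / r) := by ring

/-- Removing one sample moves the ridge regression minimizer by at most a multiple of the residual
at that sample. -/
theorem ridge_norm_sub_le [DecidableEq ι] {s : Finset ι} {i : ι} (hi : i ∈ s) (T : ι → H →L[ℝ] Y)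
    (y : ι → Y) {c lam κ R : ℝ} (f f' : H) (hc : 0 ≤ c) (hlam : 0 < lam) (hκ : 0 ≤ κ)
    (hT : ∀ g, ‖T i g‖ ≤ κ * ‖g‖) (hR : ‖y i - T i f‖ ≤ R)
    (hf : ∀ g : H, c * ∑ k ∈ s, ‖y k - T k f‖ ^ 2 + lam * ‖f‖ ^ 2 ≤
      c * ∑ k ∈ s, ‖y k - T k g‖ ^ 2 + lam * ‖g‖ ^ 2)
    (hf' : ∀ g : H, c * ∑ k ∈ s.erase i, ‖y k - T k f'‖ ^ 2 + lam * ‖f'‖ ^ 2 ≤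
      c * ∑ k ∈ s.erase i, ‖y k - T k g‖ ^ 2 + lam * ‖g‖ ^ 2) :
    ‖f - f'‖ ≤ c * (R * κ) / lam := by
  have hE := ridge_normal_equation s T y c lam f hf (f - f')
  have hE' := ridge_normal_equation (s.erase i) T y c lam f' hf' (f - f')
  rw [← Finset.add_sum_erase s _ hi] at hE
  have hdiff : ∑ k ∈ s.erase i, ⟪y k - T k f, T k (f - f')⟫_ℝ =
      ∑ k ∈ s.erase i, ⟪y k - T k f', T k (f - f')⟫_ℝ - ∑ k ∈ s.erase i, ‖T k (f - f')‖ ^ 2 := by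
    rw [← Finset.sum_sub_distrib]
    refine Finset.sum_congr rfl fun k _ ↦ ?_
    rw [← real_inner_self_eq_norm_sq, ← inner_sub_left, map_sub]
    congr 1
    abel
  have hnorm : ⟪f, f - f'⟫_ℝ - ⟪f', f - f'⟫_ℝ = ‖f - f'‖ ^ 2 := by
    rw [← inner_sub_left, real_inner_self_eq_norm_sq]
  have hinner : ⟪y i - T i f, T i (f - f')⟫_ℝ ≤ R * (κ * ‖f - f'‖) :=
    (real_inner_le_norm _ _).trans
      (mul_le_mul hR (hT _) (norm_nonneg _) ((norm_nonneg _).trans hR))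
  have hnonneg : 0 ≤ c * ∑ k ∈ s.erase i, ‖T k (f - f')‖ ^ 2 := by positivity
  have hmain : lam * ‖f - f'‖ ^ 2 ≤ c * (R * (κ * ‖f - f'‖)) := by
    rw [hdiff] at hE
    rw [← hnorm]
    linarith [mul_le_mul_of_nonneg_left hinner hc]
  rw [le_div_iff₀ hlam]
  rcases (norm_nonneg (f - f')).eq_or_lt with h0 | hpos
  · rw [← h0, zero_mul]
    exact mul_nonneg hc (mul_nonneg ((norm_nonneg _).trans hR) hκ)
  · exact le_of_mul_le_mul_right (by linarith) hpos

end RidgeRegression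

theorem abs_norm_sq_sub_norm_sq_le {E : Type*} [SeminormedAddCommGroup E] {a b : E} {R : ℝ}
    (ha : ‖a‖ ≤ R) (hb : ‖b‖ ≤ R) : |‖a‖ ^ 2 - ‖b‖ ^ 2| ≤ 2 * R * ‖a - b‖ := by
  rw [sq_sub_sq, abs_mul, abs_of_nonneg (by positivity)]
  exact mul_le_mul (by linarith) (abs_norm_sub_norm_le a b) (abs_nonneg _)
    (by linarith [norm_nonneg a])

/-- Uniform stability of functional-response ridge regression:
`β = 2C_y²κ²(1 + κ/√λ)²/(mλ)`. -/
theorem stmt8 {X Y H : Type*}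
    [NormedAddCommGroup Y] [InnerProductSpace ℝ Y]
    [NormedAddCommGroup H] [InnerProductSpace ℝ H]
    (ev : X → (H →L[ℝ] Y)) (κ : ℝ) (hκ : 0 < κ)
    (hev : ∀ (x : X) (f : H), ‖ev x f‖ ≤ κ * ‖f‖)
    (m : ℕ) (hm : 1 ≤ m) (lam : ℝ) (hlam : 0 < lam) (Cy : ℝ) (hCy : 0 < Cy)
    (x : Fin m → X) (y : Fin m → Y)
    (hy : ∀ k, ‖y k‖ ≤ Cy)
    (i : Fin m) (fZ fZi : H)
    (hfZ : ∀ g : H,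
      (1 / (m : ℝ)) * ∑ k, ‖y k - ev (x k) fZ‖ ^ 2 + lam * ‖fZ‖ ^ 2 ≤
      (1 / (m : ℝ)) * ∑ k, ‖y k - ev (x k) g‖ ^ 2 + lam * ‖g‖ ^ 2)
    (hfZi : ∀ g : H,
      (1 / (m : ℝ)) * ∑ k ∈ Finset.univ.erase i, ‖y k - ev (x k) fZi‖ ^ 2 + lam * ‖fZi‖ ^ 2 ≤
      (1 / (m : ℝ)) * ∑ k ∈ Finset.univ.erase i, ‖y k - ev (x k) g‖ ^ 2 + lam * ‖g‖ ^ 2) :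
    ∀ (x' : X) (y' : Y), ‖y'‖ ≤ Cy →
      |‖y' - ev x' fZ‖ ^ 2 - ‖y' - ev x' fZi‖ ^ 2| ≤
        2 * Cy ^ 2 * κ ^ 2 * (1 + κ / Real.sqrt lam) ^ 2 / (m * lam) := by
  intro x' y' hy'
  have hm0 : (0 : ℝ) < m := by exact_mod_cast hm
  have hc : (0 : ℝ) ≤ 1 / m := by positivity
  have hZ : ‖fZ‖ ≤ Cy / √lam :=
    ridge_norm_le Finset.univ (fun k ↦ ev (x k)) y fZ hc (by simp [hm0.ne']) hlam hCy.le
      (fun k _ ↦ hy k) hfZ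
  have hcard : 1 / (m : ℝ) * ((Finset.univ.erase i).card : ℝ) ≤ 1 := by
    rw [one_div_mul_eq_div, div_le_one hm0]
    exact_mod_cast (Finset.card_erase_le).trans (Finset.card_fin m).le
  have hZi : ‖fZi‖ ≤ Cy / √lam :=
    ridge_norm_le (Finset.univ.erase i) (fun k ↦ ev (x k)) y fZi hc hcard hlam hCy.le
      (fun k _ ↦ hy k) hfZi
  have hd := ridge_norm_sub_le (Finset.mem_univ i) (fun k ↦ ev (x k)) y fZ fZi hc hlam hκ.le
    (hev (x i)) (norm_sub_apply_le hκ.le (hev _ _) (hy i) hZ) hfZ hfZi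
  calc |‖y' - ev x' fZ‖ ^ 2 - ‖y' - ev x' fZi‖ ^ 2|
      ≤ 2 * (Cy * (1 + κ / √lam)) * ‖(y' - ev x' fZ) - (y' - ev x' fZi)‖ :=
        abs_norm_sq_sub_norm_sq_le (norm_sub_apply_le hκ.le (hev _ _) hy' hZ)
          (norm_sub_apply_le hκ.le (hev _ _) hy' hZi)
    _ = 2 * (Cy * (1 + κ / √lam)) * ‖ev x' (fZ - fZi)‖ := by
        rw [sub_sub_sub_cancel_left, norm_sub_rev, map_sub]
    _ ≤ 2 * (Cy * (1 + κ / √lam)) * (κ * (1 / m * (Cy * (1 + κ / √lam) * κ) / lam)) := by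
        gcongr
        exact (hev _ _).trans (mul_le_mul_of_nonneg_left hd hκ.le)
    _ = 2 * Cy ^ 2 * κ ^ 2 * (1 + κ / √lam) ^ 2 / (m * lam) := by
        rw [mul_comm (m : ℝ), ← div_div]
        ring
end

section
/- (Uniform stability of vector-valued support vector regression.) Let ε ≥ 0 and let c(y,a) = max(‖y − a‖_Y − ε, 0) be the ε-insensitive loss. Fix i ∈ {1,…,m}, let f_Z ∈ H be a global minimizer over H of f ↦ (1/m)∑_{k=1}^m c(y_k, ev x_k f) + λ‖f‖_H², and let f_{Z∖i} ∈ H be a global minimizer over H of f ↦ (1/m)∑_{k≠i} c(y_k, ev x_k f) + λ‖f‖_H². Then for every x ∈ X and every y ∈ Y, |c(y, ev x f_Z) − c(y, ev x f_{Z∖i})| ≤ κ²/(2mλ); i.e., the vector-valued SVR algorithm is β-uniformly stable with β = κ²/(2mλ). -/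
open scoped InnerProductSpace

/-- The `ε`-insensitive loss of an affine residual is convex. -/
theorem convexOn_epsInsensitive {Y H : Type*}
    [NormedAddCommGroup Y] [InnerProductSpace ℝ Y]
    [NormedAddCommGroup H] [InnerProductSpace ℝ H] (A : H →L[ℝ] Y) (y : Y) (ε : ℝ) :
    ConvexOn ℝ Set.univ fun g : H => max (‖y - A g‖ - ε) 0 := by
  have h : ConvexOn ℝ Set.univ fun g : H => ‖y - A g‖ := by
    refine ⟨convex_univ, fun f _ g _ a b ha hb hab => ?_⟩
    have e : y - A (a • f + b • g) = a • (y - A f) + b • (y - A g) := by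
      have : y = a • y + b • y := by rw [← add_smul, hab, one_smul]
      nth_rewrite 1 [this]
      simp only [map_add, map_smul, smul_sub]
      abel
    simp only [e, smul_eq_mul]
    refine (norm_add_le _ _).trans ?_
    rw [norm_smul_of_nonneg ha, norm_smul_of_nonneg hb]
  exact (h.sub (concaveOn_const ε convex_univ)).sup (convexOn_const 0 convex_univ)

/-- Quadratic growth of a Tikhonov-regularized convex functional away from its minimizer. -/
theorem ConvexOn.quadratic_growth_of_regularized_min {H : Type*}
    [NormedAddCommGroup H] [InnerProductSpace ℝ H] {R : H → ℝ} (hR : ConvexOn ℝ Set.univ R)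
    {lam : ℝ} {f : H} (hf : ∀ g, R f + lam * ‖f‖ ^ 2 ≤ R g + lam * ‖g‖ ^ 2) (g : H) :
    R f + lam * ‖f‖ ^ 2 + lam * ‖f - g‖ ^ 2 ≤ R g + lam * ‖g‖ ^ 2 := by
  have key : ∀ t ∈ Set.Ioo (0 : ℝ) 1,
      R f + lam * ‖f‖ ^ 2 + (1 - t) * (lam * ‖f - g‖ ^ 2) ≤ R g + lam * ‖g‖ ^ 2 := by
    rintro t ⟨ht0, ht1⟩
    have h1 := hf ((1 - t) • f + t • g)
    have h2 := hR.2 (Set.mem_univ f) (Set.mem_univ g) (sub_nonneg.2 ht1.le) ht0.le (by ring)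
    have h3 : ‖(1 - t) • f + t • g‖ ^ 2 =
        (1 - t) * ‖f‖ ^ 2 + t * ‖g‖ ^ 2 - t * (1 - t) * ‖f - g‖ ^ 2 := by
      rw [norm_add_sq_real, norm_sub_sq_real, norm_smul_of_nonneg (sub_nonneg.2 ht1.le),
        norm_smul_of_nonneg ht0.le, real_inner_smul_left, real_inner_smul_right]
      ring
    rw [h3] at h1
    simp only [smul_eq_mul] at h2
    refine le_of_mul_le_mul_left ?_ ht0
    linarith
  have lim : Filter.Tendsto
      (fun t : ℝ => R f + lam * ‖f‖ ^ 2 + (1 - t) * (lam * ‖f - g‖ ^ 2))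
      (nhdsWithin 0 (Set.Ioi 0)) (nhds (R f + lam * ‖f‖ ^ 2 + lam * ‖f - g‖ ^ 2)) := by
    refine Filter.Tendsto.mono_left ?_ nhdsWithin_le_nhds
    have : Continuous fun t : ℝ =>
      R f + lam * ‖f‖ ^ 2 + (1 - t) * (lam * ‖f - g‖ ^ 2) := by fun_prop
    simpa using this.tendsto 0
  exact le_of_tendsto lim
    (Filter.eventually_of_mem (Ioo_mem_nhdsGT zero_lt_one) key)

/-- The averaged `ε`-insensitive empirical risk is convex. -/
theorem convexOn_empiricalRisk {X Y H ι : Type*}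
    [NormedAddCommGroup Y] [InnerProductSpace ℝ Y]
    [NormedAddCommGroup H] [InnerProductSpace ℝ H]
    (ev : X → (H →L[ℝ] Y)) (x : ι → X) (y : ι → Y) (ε : ℝ) {c : ℝ} (hc : 0 ≤ c)
    (s : Finset ι) :
    ConvexOn ℝ Set.univ fun g : H => c * ∑ k ∈ s, max (‖y k - ev (x k) g‖ - ε) 0 := by
  have h : ConvexOn ℝ Set.univ fun g : H => ∑ k ∈ s, max (‖y k - ev (x k) g‖ - ε) 0 := by
    classical
    induction s using Finset.induction_on with
    | empty => simpa using convexOn_const (0 : ℝ) convex_univ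
    | insert k s hk ih =>
      simp only [Finset.sum_insert hk]
      exact (convexOn_epsInsensitive (ev (x k)) (y k) ε).add ih
  exact h.smul hc

/-- The `ε`-insensitive loss is Lipschitz in the predictor. -/
theorem abs_epsInsensitive_sub_le {Y H : Type*}
    [NormedAddCommGroup Y] [InnerProductSpace ℝ Y]
    [NormedAddCommGroup H] [InnerProductSpace ℝ H] (A : H →L[ℝ] Y) {κ : ℝ}
    (hA : ∀ f, ‖A f‖ ≤ κ * ‖f‖) (y : Y) (ε : ℝ) (f g : H) :
    |max (‖y - A f‖ - ε) 0 - max (‖y - A g‖ - ε) 0| ≤ κ * ‖f - g‖ := by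
  refine (abs_max_sub_max_le_abs _ _ _).trans ?_
  rw [sub_sub_sub_cancel_right]
  refine (abs_norm_sub_norm_le _ _).trans ?_
  rw [sub_sub_sub_cancel_left, ← map_sub, norm_sub_rev f g]
  exact hA _

/-- Uniform stability of vector-valued support vector regression with the
ε-insensitive loss: `β = κ²/(2mλ)`. -/
theorem stmt11 {X Y H : Type*}
    [NormedAddCommGroup Y] [InnerProductSpace ℝ Y]
    [NormedAddCommGroup H] [InnerProductSpace ℝ H]
    (ev : X → (H →L[ℝ] Y)) (κ : ℝ) (hκ : 0 < κ)
    (hev : ∀ (x : X) (f : H), ‖ev x f‖ ≤ κ * ‖f‖)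
    (m : ℕ) (hm : 1 ≤ m) (lam : ℝ) (hlam : 0 < lam)
    (ε : ℝ) (hε : 0 ≤ ε)
    (x : Fin m → X) (y : Fin m → Y)
    (i : Fin m) (fZ fZi : H)
    (hfZ : ∀ g : H,
      (1 / (m : ℝ)) * ∑ k, max (‖y k - ev (x k) fZ‖ - ε) 0 + lam * ‖fZ‖ ^ 2 ≤
      (1 / (m : ℝ)) * ∑ k, max (‖y k - ev (x k) g‖ - ε) 0 + lam * ‖g‖ ^ 2)
    (hfZi : ∀ g : H,
      (1 / (m : ℝ)) * ∑ k ∈ Finset.univ.erase i, max (‖y k - ev (x k) fZi‖ - ε) 0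
          + lam * ‖fZi‖ ^ 2 ≤
      (1 / (m : ℝ)) * ∑ k ∈ Finset.univ.erase i, max (‖y k - ev (x k) g‖ - ε) 0
          + lam * ‖g‖ ^ 2) :
    ∀ (x' : X) (y' : Y),
      |max (‖y' - ev x' fZ‖ - ε) 0 - max (‖y' - ev x' fZi‖ - ε) 0| ≤
        κ ^ 2 / (2 * m * lam) := by
  intro x' y'
  have hm' : (0 : ℝ) < m := by exact_mod_cast hm
  have hc : (0 : ℝ) ≤ 1 / m := by positivity
  have g1 := (convexOn_empiricalRisk ev x y ε hc Finset.univ).quadratic_growth_of_regularized_min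
    hfZ fZi
  have g2 := (convexOn_empiricalRisk ev x y ε hc
    (Finset.univ.erase i)).quadratic_growth_of_regularized_min hfZi fZ
  rw [norm_sub_rev fZi fZ] at g2
  simp only [← Finset.add_sum_erase Finset.univ _ (Finset.mem_univ i), mul_add] at g1
  have hi := (abs_le.1 (abs_epsInsensitive_sub_le (ev (x i)) (hev (x i)) (y i) ε fZ fZi)).1
  have hi' := mul_le_mul_of_nonneg_left hi hc
  have hd : 2 * lam * ‖fZ - fZi‖ ^ 2 ≤ 1 / m * (κ * ‖fZ - fZi‖) := by linarith
  have hdist : ‖fZ - fZi‖ ≤ κ / (2 * m * lam) := by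
    rcases (norm_nonneg (fZ - fZi)).eq_or_lt with h0 | h0
    · rw [← h0]
      positivity
    · rw [le_div_iff₀ (by positivity)]
      have h1 : 2 * lam * ‖fZ - fZi‖ ≤ 1 / m * κ := by
        refine le_of_mul_le_mul_right ?_ h0
        linarith
      rw [one_div_mul_eq_div, le_div_iff₀ hm'] at h1
      linarith
  calc _ ≤ κ * ‖fZ - fZi‖ := abs_epsInsensitive_sub_le (ev x') (hev x') y' ε fZ fZi
    _ ≤ κ * (κ / (2 * m * lam)) := by gcongr
    _ = κ ^ 2 / (2 * m * lam) := by ring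
end

section
/- (Uniform stability of multi-task kernel logistic regression.) Let c(y,a) = ln(1 + exp(−⟪y, a⟫_Y)) and assume ‖y_k‖_Y ≤ 1 for all k = 1,…,m. Fix i ∈ {1,…,m}, let f_Z ∈ H be a global minimizer over H of f ↦ (1/m)∑_{k=1}^m c(y_k, ev x_k f) + λ‖f‖_H², and let f_{Z∖i} ∈ H be a global minimizer over H of f ↦ (1/m)∑_{k≠i} c(y_k, ev x_k f) + λ‖f‖_H². Then for every x ∈ X and every y ∈ Y with ‖y‖_Y ≤ 1, |c(y, ev x f_Z) − c(y, ev x f_{Z∖i})| ≤ κ²/(2mλ); i.e., the multi-task logistic regression algorithm is β-uniformly stable with β = κ²/(2mλ). -/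
open scoped InnerProductSpace

/-- The minimizer `f` of a `lam`-regularized convex functional beats any competitor `g` by at
least `lam * ‖g - f‖ ^ 2`. -/
lemma ConvexOn.add_mul_sq_norm_sub_le_of_minimizer {H : Type*}
    [NormedAddCommGroup H] [InnerProductSpace ℝ H] {J : H → ℝ}
    (hJ : ConvexOn ℝ Set.univ J) {lam : ℝ} {f : H}
    (hf : ∀ g, J f + lam * ‖f‖ ^ 2 ≤ J g + lam * ‖g‖ ^ 2) (g : H) :
    J f + lam * ‖f‖ ^ 2 + lam * ‖g - f‖ ^ 2 ≤ J g + lam * ‖g‖ ^ 2 := by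
  have bound : ∀ t : ℝ, 0 < t → t < 1 →
      J f + lam * ‖f‖ ^ 2 + lam * (1 - t) * ‖g - f‖ ^ 2 ≤ J g + lam * ‖g‖ ^ 2 := by
    intro t ht ht1
    have hconv := hJ.2 (Set.mem_univ f) (Set.mem_univ g) (sub_nonneg.2 ht1.le) ht.le
      (sub_add_cancel 1 t)
    have hmin := hf ((1 - t) • f + t • g)
    have hsq : ‖(1 - t) • f + t • g‖ ^ 2 =
        (1 - t) * ‖f‖ ^ 2 + t * ‖g‖ ^ 2 - t * (1 - t) * ‖g - f‖ ^ 2 := by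
      rw [norm_add_sq_real, norm_sub_sq_real, real_inner_smul_left, real_inner_smul_right,
        norm_smul, norm_smul, mul_pow, mul_pow, Real.norm_eq_abs, Real.norm_eq_abs, sq_abs,
        sq_abs, real_inner_comm f g]
      ring
    rw [hsq] at hmin
    simp only [smul_eq_mul] at hconv
    refine le_of_mul_le_mul_left ?_ ht
    linarith
  have hlim : Filter.Tendsto
      (fun t : ℝ => J f + lam * ‖f‖ ^ 2 + lam * (1 - t) * ‖g - f‖ ^ 2)
      (nhdsWithin 0 (Set.Ioi 0)) (nhds (J f + lam * ‖f‖ ^ 2 + lam * (1 - 0) * ‖g - f‖ ^ 2)) :=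
    (Continuous.tendsto (by fun_prop) 0).mono_left nhdsWithin_le_nhds
  rw [sub_zero, mul_one] at hlim
  refine le_of_tendsto hlim ?_
  filter_upwards [Ioo_mem_nhdsGT (zero_lt_one' ℝ)] with t ht
  exact bound t ht.1 ht.2

lemma convexOn_log_one_add_exp_neg :
    ConvexOn ℝ Set.univ (fun t : ℝ => Real.log (1 + Real.exp (-t))) := by
  have hderiv : ∀ t : ℝ, HasDerivAt (fun t : ℝ => Real.log (1 + Real.exp (-t)))
      (-(1 - (1 + Real.exp (-t))⁻¹)) t := by
    intro t
    have hpos : 1 + Real.exp (-t) ≠ 0 := by positivity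
    convert (((hasDerivAt_neg t).exp).const_add 1).log hpos using 1
    field_simp
    ring
  refine Monotone.convexOn_univ_of_deriv (fun t => (hderiv t).differentiableAt) ?_
  intro s t hst
  rw [(hderiv s).deriv, (hderiv t).deriv]
  gcongr

lemma abs_log_one_add_exp_neg_sub_le (s t : ℝ) :
    |Real.log (1 + Real.exp (-s)) - Real.log (1 + Real.exp (-t))| ≤ |s - t| := by
  have one_sided : ∀ s t : ℝ,
      Real.log (1 + Real.exp (-s)) - Real.log (1 + Real.exp (-t)) ≤ |s - t| := by
    intro s t
    rw [sub_le_iff_le_add, Real.log_le_iff_le_exp (by positivity), Real.exp_add,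
      Real.exp_log (by positivity), mul_add, mul_one, ← Real.exp_add]
    refine add_le_add (Real.one_le_exp (abs_nonneg _)) (Real.exp_le_exp.2 ?_)
    linarith [neg_abs_le (s - t)]
  exact abs_sub_le_iff.2 ⟨one_sided s t, abs_sub_comm s t ▸ one_sided t s⟩

lemma abs_logistic_loss_sub_le {Y H : Type*}
    [NormedAddCommGroup Y] [InnerProductSpace ℝ Y]
    [NormedAddCommGroup H] [InnerProductSpace ℝ H]
    {L : H →L[ℝ] Y} {κ : ℝ} (hL : ∀ f, ‖L f‖ ≤ κ * ‖f‖) {y : Y} (hy : ‖y‖ ≤ 1) (f g : H) :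
    |Real.log (1 + Real.exp (-⟪y, L f⟫_ℝ)) - Real.log (1 + Real.exp (-⟪y, L g⟫_ℝ))| ≤
      κ * ‖f - g‖ := by
  calc
    _ ≤ |⟪y, L f⟫_ℝ - ⟪y, L g⟫_ℝ| := abs_log_one_add_exp_neg_sub_le _ _
    _ = |⟪y, L (f - g)⟫_ℝ| := by rw [map_sub, inner_sub_right]
    _ ≤ ‖y‖ * ‖L (f - g)‖ := abs_real_inner_le_norm _ _
    _ ≤ ‖L (f - g)‖ := mul_le_of_le_one_left (norm_nonneg _) hy
    _ ≤ κ * ‖f - g‖ := hL _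

lemma convexOn_sum_logistic_loss {ι Y H : Type*}
    [NormedAddCommGroup Y] [InnerProductSpace ℝ Y]
    [NormedAddCommGroup H] [InnerProductSpace ℝ H]
    (L : ι → H →L[ℝ] Y) (y : ι → Y) (s : Finset ι) {c : ℝ} (hc : 0 ≤ c) :
    ConvexOn ℝ Set.univ
      (fun f : H => c * ∑ k ∈ s, Real.log (1 + Real.exp (-⟪y k, L k f⟫_ℝ))) := by
  have hloss : ∀ k, ConvexOn ℝ Set.univ
      (fun f : H => Real.log (1 + Real.exp (-⟪y k, L k f⟫_ℝ))) := fun k =>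
    convexOn_log_one_add_exp_neg.comp_linearMap ((innerSL ℝ (y k)).comp (L k)).toLinearMap
  refine ConvexOn.smul hc ⟨convex_univ, fun f _ g _ a b ha hb hab => ?_⟩
  rw [Finset.smul_sum, Finset.smul_sum, ← Finset.sum_add_distrib]
  exact Finset.sum_le_sum fun k _ =>
    (hloss k).2 (Set.mem_univ f) (Set.mem_univ g) ha hb hab

/-- Uniform stability of multi-task kernel logistic regression with the loss
`c(y,a) = ln(1 + exp(−⟪y,a⟫))` and unit-norm-bounded outputs: `β = κ²/(2mλ)`. -/
theorem stmt14 {X Y H : Type*}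
    [NormedAddCommGroup Y] [InnerProductSpace ℝ Y]
    [NormedAddCommGroup H] [InnerProductSpace ℝ H]
    (ev : X → (H →L[ℝ] Y)) (κ : ℝ) (hκ : 0 < κ)
    (hev : ∀ (x : X) (f : H), ‖ev x f‖ ≤ κ * ‖f‖)
    (m : ℕ) (hm : 1 ≤ m) (lam : ℝ) (hlam : 0 < lam)
    (x : Fin m → X) (y : Fin m → Y)
    (hy : ∀ k, ‖y k‖ ≤ 1)
    (i : Fin m) (fZ fZi : H)
    (hfZ : ∀ g : H,
      (1 / (m : ℝ)) * ∑ k, Real.log (1 + Real.exp (-⟪y k, ev (x k) fZ⟫_ℝ))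
          + lam * ‖fZ‖ ^ 2 ≤
      (1 / (m : ℝ)) * ∑ k, Real.log (1 + Real.exp (-⟪y k, ev (x k) g⟫_ℝ))
          + lam * ‖g‖ ^ 2)
    (hfZi : ∀ g : H,
      (1 / (m : ℝ)) * ∑ k ∈ Finset.univ.erase i,
          Real.log (1 + Real.exp (-⟪y k, ev (x k) fZi⟫_ℝ)) + lam * ‖fZi‖ ^ 2 ≤
      (1 / (m : ℝ)) * ∑ k ∈ Finset.univ.erase i,
          Real.log (1 + Real.exp (-⟪y k, ev (x k) g⟫_ℝ)) + lam * ‖g‖ ^ 2) :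
    ∀ (x' : X) (y' : Y), ‖y'‖ ≤ 1 →
      |Real.log (1 + Real.exp (-⟪y', ev x' fZ⟫_ℝ)) -
        Real.log (1 + Real.exp (-⟪y', ev x' fZi⟫_ℝ))| ≤ κ ^ 2 / (2 * m * lam) := by
  intro x' y' hy'
  have hm0 : (0 : ℝ) < m := by exact_mod_cast hm
  have hc : (0 : ℝ) ≤ 1 / (m : ℝ) := by positivity
  have gap := (convexOn_sum_logistic_loss (fun k => ev (x k)) y Finset.univ
    hc).add_mul_sq_norm_sub_le_of_minimizer hfZ fZi
  have gap_erase := (convexOn_sum_logistic_loss (fun k => ev (x k)) y (Finset.univ.erase i)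
    hc).add_mul_sq_norm_sub_le_of_minimizer hfZi fZ
  rw [← Finset.add_sum_erase _ _ (Finset.mem_univ i),
    ← Finset.add_sum_erase _ _ (Finset.mem_univ i), norm_sub_rev] at gap
  have loss_i := (le_abs_self _).trans
    ((abs_sub_comm _ _).trans_le (abs_logistic_loss_sub_le (hev (x i)) (hy i) fZ fZi))
  have hsq : 2 * lam * ‖fZ - fZi‖ ^ 2 ≤ 1 / (m : ℝ) * (κ * ‖fZ - fZi‖) := by
    linarith [mul_le_mul_of_nonneg_left loss_i hc]
  have hdist : ‖fZ - fZi‖ ≤ κ / (2 * m * lam) := by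
    rcases (norm_nonneg (fZ - fZi)).eq_or_lt with h0 | hpos
    · rw [← h0]
      positivity
    · rw [le_div_iff₀ (by positivity)]
      refine le_of_mul_le_mul_right ?_ hpos
      rw [one_div, ← div_eq_inv_mul, le_div_iff₀ hm0] at hsq
      linarith
  calc
    _ ≤ κ * ‖fZ - fZi‖ := abs_logistic_loss_sub_le (hev x') hy' fZ fZi
    _ ≤ κ * (κ / (2 * m * lam)) := by gcongr
    _ = κ ^ 2 / (2 * m * lam) := by ring
end
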